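/- Let G^s be an SCG, t ∈ ℤ, γ ≥ 0 an integer, and X, Y ∈ V distinct with X an ancestor of Y in G^s. Assume that none of the following holds: (1) γ ≠ 0 and Cycles^>(X, G^s \ {Y}) ≠ ∅; (2) there exists a σ-active (given the empty set) backdoor path π^s = ⟨V^1 = X, V^2, …, V^{n−1}, V^n = Y⟩ from X to Y in G^s with {V^2, …, V^{n−1}} ⊆ Desc(X, G^s) such that one of the following holds: (a) n > 2; (b) n = 2 and γ ≠ 1; (c) n = 2, γ = 1 and Cycles(Y, G^s) \ {X ⇄ Y} ≠ ∅. Then A_γ satisfies the backdoor criterion over all candidate FTCGs relative to ((X, t−γ), (Y, t)). (Graph-theoretic form of Theorem 2: under these conditions the total effect P(y_t | do(x_{t−γ})) is identifiable from G^s.) -/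

import Mathlib

/-- `u` is an ancestor of `v` (equivalently, `v` is a descendant of `u`):
there is a possibly empty directed path from `u` to `v` in the directed graph
with edge relation `E`. -/
def Anc {α : Type*} (E : α → α → Prop) (u v : α) : Prop :=
  Relation.ReflTransGen E u v

/-- A directed graph is acyclic if there is no nonempty directed path
from a vertex to itself. -/
def Acyclic {α : Type*} (E : α → α → Prop) : Prop :=
  ∀ v, ¬ Relation.TransGen E v v

/-- A path in a directed graph, given as a sequence of `n + 1` pairwise
distinct vertices `w 0, …, w n` (with `n ≥ 1`) together with a chosen
direction for each step: `dir i = true` means the chosen edge is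
`w i → w (i+1)`, and `dir i = false` means it is `w (i+1) → w i`. -/
structure DPath {α : Type*} (E : α → α → Prop) where
  n : ℕ
  pos : 1 ≤ n
  w : ℕ → α
  dir : ℕ → Bool
  inj : ∀ i j, i ≤ n → j ≤ n → w i = w j → i = j
  valid : ∀ i, i < n →
    (dir i = true → E (w i) (w (i + 1))) ∧ (dir i = false → E (w (i + 1)) (w i))

/-- The path runs between `u` and `v`. -/
def DPath.Between {α : Type*} {E : α → α → Prop} (π : DPath E) (u v : α) : Prop :=
  π.w 0 = u ∧ π.w π.n = v

/-- A backdoor path: the first chosen edge points into the first vertex. -/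
def DPath.Backdoor {α : Type*} {E : α → α → Prop} (π : DPath E) : Prop :=
  π.dir 0 = false

/-- The non-endpoint vertex at position `i` is a collider on the path:
both chosen edges at it point into it. -/
def DPath.ColliderAt {α : Type*} {E : α → α → Prop} (π : DPath E) (i : ℕ) : Prop :=
  0 < i ∧ i < π.n ∧ π.dir (i - 1) = true ∧ π.dir i = false

/-- The non-endpoint vertex at position `i` is a definite non-collider:
at least one of the two chosen edges at it points out of it. -/
def DPath.DefNonColliderAt {α : Type*} {E : α → α → Prop} (π : DPath E) (i : ℕ) : Prop :=
  0 < i ∧ i < π.n ∧ (π.dir (i - 1) = false ∨ π.dir i = true)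

/-- A set `Z` blocks a path if some definite non-collider on the path belongs
to `Z`, or some collider on the path has no descendant in `Z`. -/
def Blocks {α : Type*} {E : α → α → Prop} (Z : Set α) (π : DPath E) : Prop :=
  (∃ i, π.DefNonColliderAt i ∧ π.w i ∈ Z) ∨
  (∃ i, π.ColliderAt i ∧ ∀ z ∈ Z, ¬ Anc E (π.w i) z)

/-- Map a path along an inclusion of edge relations (same vertices, same
chosen directions). -/
def DPath.map {α : Type*} {E E' : α → α → Prop} (h : ∀ a b, E a b → E' a b)
    (π : DPath E) : DPath E' where
  n := π.n
  pos := π.pos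
  w := π.w
  dir := π.dir
  inj := π.inj
  valid := fun i hi =>
    ⟨fun hd => h _ _ ((π.valid i hi).1 hd), fun hd => h _ _ ((π.valid i hi).2 hd)⟩

/-- Temporal priority: every edge goes weakly forward in time, and strictly
forward between two instances of the same time series. -/
def TemporalPriority {V : Type*} (F : V × ℤ → V × ℤ → Prop) : Prop :=
  ∀ A B : V, ∀ s t : ℤ, F (A, s) (B, t) → s ≤ t ∧ (A = B → s < t)

/-- Maximal lag `γmax`: every edge has lag at most `γmax`. -/
def MaxLag {V : Type*} (γmax : ℤ) (F : V × ℤ → V × ℤ → Prop) : Prop :=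
  ∀ A B : V, ∀ s t : ℤ, F (A, s) (B, t) → t - s ≤ γmax

/-- Consistency throughout time: the edge relation is invariant under
simultaneous time shifts. -/
def ConsistentThroughTime {V : Type*} (F : V × ℤ → V × ℤ → Prop) : Prop :=
  ∀ A B : V, ∀ s t k : ℤ, F (A, s) (B, t) ↔ F (A, s + k) (B, t + k)

/-- The extended summary causal graph (ESCG) derived from an FTCG `F`:
vertices `Sum.inl A` represent `A_{t^-}` (past slice) and `Sum.inr A`
represent `A_t` (present slice). -/
def derivedESCG {V : Type*} (γmax : ℤ) (F : V × ℤ → V × ℤ → Prop) :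
    (V ⊕ V) → (V ⊕ V) → Prop
  | Sum.inr A, Sum.inr B => F (A, 0) (B, 0)
  | Sum.inl A, Sum.inr B => ∃ γ : ℤ, 1 ≤ γ ∧ γ ≤ γmax ∧ F (A, -γ) (B, 0)
  | _, _ => False

/-- A candidate FTCG for an ESCG `e`: an FTCG satisfying temporal priority,
maximal lag `γmax`, consistency throughout time and acyclicity whose derived
ESCG is `e`. -/
def CandidateESCG {V : Type*} (γmax : ℤ) (e : (V ⊕ V) → (V ⊕ V) → Prop)
    (F : V × ℤ → V × ℤ → Prop) : Prop :=
  TemporalPriority F ∧ MaxLag γmax F ∧ ConsistentThroughTime F ∧ Acyclic F ∧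
    derivedESCG γmax F = e

/-- The summary causal graph (SCG) derived from an FTCG `F`. -/
def derivedSCG {V : Type*} (γmax : ℤ) (F : V × ℤ → V × ℤ → Prop) : V → V → Prop :=
  fun A B => ∃ t γ : ℤ, 0 ≤ γ ∧ γ ≤ γmax ∧ F (A, t - γ) (B, t)

/-- A candidate FTCG for an SCG `S`. -/
def CandidateSCG {V : Type*} (γmax : ℤ) (S : V → V → Prop)
    (F : V × ℤ → V × ℤ → Prop) : Prop :=
  TemporalPriority F ∧ MaxLag γmax F ∧ ConsistentThroughTime F ∧ Acyclic F ∧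
    derivedSCG γmax F = S

/-- The densest candidate FTCG for an ESCG `e`. -/
def densestFTCG {V : Type*} (γmax : ℤ) (e : (V ⊕ V) → (V ⊕ V) → Prop) :
    V × ℤ → V × ℤ → Prop :=
  fun p q =>
    (p.2 = q.2 ∧ e (Sum.inr p.1) (Sum.inr q.1)) ∨
    (∃ ℓ : ℤ, 1 ≤ ℓ ∧ ℓ ≤ γmax ∧ p.2 = q.2 - ℓ ∧ e (Sum.inl p.1) (Sum.inr q.1))

/-- The adjustment set `B_γ` for an ESCG `e`, variable `X`, time `t`, lag `γ`. -/
def Bset {V : Type*} (γmax : ℤ) (e : (V ⊕ V) → (V ⊕ V) → Prop)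
    (X : V) (t γ : ℤ) : Set (V × ℤ) :=
  {p | (∃ ℓ : ℤ, 1 ≤ ℓ ∧ ℓ ≤ γmax ∧ p.2 = t - γ - ℓ ∧ e (Sum.inl p.1) (Sum.inr X)) ∨
       (p.2 = t - γ ∧ e (Sum.inr p.1) (Sum.inr X))}

/-- The adjustment set `A_γ` for an SCG `S`, variable `X`, time `t`, lag `γ`. -/
def Aset {V : Type*} (γmax : ℤ) (S : V → V → Prop) (X : V) (t γ : ℤ) :
    Set (V × ℤ) :=
  {p | (∃ ℓ : ℤ, 1 ≤ ℓ ∧ ℓ ≤ γmax ∧ p.2 = t - γ - ℓ ∧ Anc S X p.1) ∨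
       (∃ ℓ : ℤ, 0 ≤ ℓ ∧ ℓ ≤ γmax ∧ p.2 = t - γ - ℓ ∧ ¬ Anc S X p.1)}

/-- `Z` satisfies the backdoor criterion over all candidate FTCGs (described
by the predicate `Cand`) relative to `(x, y)`. -/
def SatisfiesBackdoorCriterionAll {V : Type*}
    (Cand : (V × ℤ → V × ℤ → Prop) → Prop)
    (Z : Set (V × ℤ)) (x y : V × ℤ) : Prop :=
  x ∉ Z ∧ y ∉ Z ∧
    ∀ F, Cand F →
      (∀ π : DPath F, π.Between x y → π.Backdoor → Blocks Z π) ∧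
      (∀ p ∈ Z, ¬ Anc F x p)

/-- The standard backdoor criterion relative to `(x, y)` in a single directed
graph: no element of `Z` is a descendant of `x`, and `Z` blocks every
backdoor path between `x` and `y`. -/
def StdBackdoorCriterion {α : Type*} (E : α → α → Prop) (Z : Set α)
    (x y : α) : Prop :=
  (∀ p ∈ Z, ¬ Anc E x p) ∧
  (∀ π : DPath E, π.Between x y → π.Backdoor → Blocks Z π)

/-- The non-endpoint vertex at position `i` σ-blocks the path given the empty
set: the edge into it from its predecessor is present but not reversible, and
likewise from its successor. -/
def DPath.SigmaBlockedAt {α : Type*} {E : α → α → Prop} (π : DPath E) (i : ℕ) : Prop :=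
  0 < i ∧ i < π.n ∧
    (E (π.w (i - 1)) (π.w i) ∧ ¬ E (π.w i) (π.w (i - 1))) ∧
    (E (π.w (i + 1)) (π.w i) ∧ ¬ E (π.w i) (π.w (i + 1)))

/-- A path is σ-active given the empty set if no non-endpoint vertex
σ-blocks it. -/
def DPath.SigmaActive {α : Type*} {E : α → α → Prop} (π : DPath E) : Prop :=
  ∀ i, ¬ π.SigmaBlockedAt i

/-- A directed cycle: vertices `w 0, …, w (m-1)` pairwise distinct, with
`w m = w 0` and edges `w i → w (i+1)`; `m = 1` is a self-loop. -/
structure DCycle {α : Type*} (E : α → α → Prop) where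
  m : ℕ
  pos : 1 ≤ m
  w : ℕ → α
  ret : w m = w 0
  inj : ∀ i j, i < m → j < m → w i = w j → i = j
  valid : ∀ i, i < m → E (w i) (w (i + 1))

/-- The cycle passes through `x`. -/
def DCycle.Through {α : Type*} {E : α → α → Prop} (c : DCycle E) (x : α) : Prop :=
  ∃ i, i < c.m ∧ c.w i = x

/-- `Cycles^>(x, E) ≠ ∅`: there is a directed cycle through `x` with at least
two distinct vertices. -/
def HasBigCycleThrough {α : Type*} (E : α → α → Prop) (x : α) : Prop :=
  ∃ c : DCycle E, c.Through x ∧ 2 ≤ c.m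

/-- The graph obtained by removing vertex `y` and all incident edges. -/
def delVertex {α : Type*} (E : α → α → Prop) (y : α) : α → α → Prop :=
  fun a b => a ≠ y ∧ b ≠ y ∧ E a b

/-- The cycle is the 2-cycle `x ⇄ y`. -/
def DCycle.IsTwoCycle {α : Type*} {E : α → α → Prop} (c : DCycle E) (x y : α) : Prop :=
  c.m = 2 ∧ ((c.w 0 = x ∧ c.w 1 = y) ∨ (c.w 0 = y ∧ c.w 1 = x))

/-- `a` and `b` lie on a common directed cycle of `E`
(`b` lies on a directed cycle through `a`). -/
def OnCommonCycle {α : Type*} (E : α → α → Prop) (a b : α) : Prop :=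
  ∃ c : DCycle E, c.Through a ∧ c.Through b

/-- A path `πf` in a candidate FTCG is compatible with a path `πs` in the SCG
`S` if every intermediate vertex `(W, u)` of `πf` satisfies: `W` is an
intermediate vertex of `πs`, or `W` lies on a directed cycle of `S` through
some intermediate vertex of `πs` but on no directed cycle of `S` through `X`. -/
def Compatible {V : Type*} {F : V × ℤ → V × ℤ → Prop} (S : V → V → Prop) (X : V)
    (πf : DPath F) (πs : DPath S) : Prop :=
  ∀ i, 0 < i → i < πf.n →
    (∃ j, 0 < j ∧ j < πs.n ∧ πs.w j = (πf.w i).1) ∨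
    (∃ j, 0 < j ∧ j < πs.n ∧ OnCommonCycle S (πs.w j) (πf.w i).1 ∧
      ¬ OnCommonCycle S X (πf.w i).1)

/-- A path in a candidate FTCG between `(X, t−γ)` and `(Y, t)` is ambiguous if
all its vertices are at times `≥ t − γ`. -/
def DPath.Ambiguous {V : Type*} {F : V × ℤ → V × ℤ → Prop} (π : DPath F)
    (t γ : ℤ) : Prop :=
  ∀ i, i ≤ π.n → t - γ ≤ (π.w i).2

section Digraph

variable {α : Type*} {E : α → α → Prop}

/-- A directed path yields one with pairwise distinct vertices. -/
theorem Anc.exists_simple {u v : α} (h : Anc E u v) :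
    ∃ (n : ℕ) (w : ℕ → α), w 0 = u ∧ w n = v ∧
      (∀ i j, i ≤ n → j ≤ n → w i = w j → i = j) ∧ ∀ i, i < n → E (w i) (w (i + 1)) := by
  induction h using Relation.ReflTransGen.head_induction_on with
  | refl => exact ⟨0, fun _ => v, rfl, rfl, fun i j hi hj _ => by omega, fun i hi => by omega⟩
  | @head a b hab _ ih =>
    obtain ⟨n, w, h0, hn, hinj, hE⟩ := ih
    by_cases hk : ∃ k, k ≤ n ∧ w k = a
    · obtain ⟨k, hkn, hka⟩ := hk
      refine ⟨n - k, fun i => w (k + i), hka, ?_, fun i j hi hj hij => ?_, fun i hi => ?_⟩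
      · simpa [Nat.add_sub_cancel' hkn] using hn
      · have := hinj (k + i) (k + j) (by omega) (by omega) hij
        omega
      · exact hE (k + i) (by omega)
    · push Not at hk
      refine ⟨n + 1, fun i => Nat.casesOn i a w, rfl, hn, fun i j hi hj hij => ?_, fun i hi => ?_⟩
      · cases i with
        | zero =>
          cases j with
          | zero => rfl
          | succ j => exact absurd hij.symm (hk j (by omega))
        | succ i =>
          cases j with
          | zero => exact absurd hij (hk i (by omega))
          | succ j => exact congrArg (· + 1) (hinj i j (by omega) (by omega) hij)
      · cases i with
        | zero => simpa [h0] using hab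
        | succ i => exact hE i (by omega)

theorem anc_of_forall_edge {w : ℕ → α} {i j : ℕ} (hij : i ≤ j)
    (h : ∀ k, i ≤ k → k < j → E (w k) (w (k + 1))) : Anc E (w i) (w j) := by
  induction j, hij using Nat.le_induction with
  | base => exact .refl
  | succ j hij ih =>
    exact (ih fun k hk hkj => h k hk (by omega)).tail (h j hij (by omega))

theorem anc_of_forall_edge_rev {w : ℕ → α} {i j : ℕ} (hij : i ≤ j)
    (h : ∀ k, i ≤ k → k < j → E (w (k + 1)) (w k)) : Anc E (w j) (w i) := by
  induction j, hij using Nat.le_induction with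
  | base => exact .refl
  | succ j hij ih =>
    exact (ih fun k hk hkj => h k hk (by omega)).head (h j hij (by omega))

/-- Closing a simple directed path by an edge from its end to its start gives a cycle. -/
theorem exists_cycle_of_simple {n : ℕ} {w : ℕ → α}
    (hinj : ∀ i j, i ≤ n → j ≤ n → w i = w j → i = j)
    (hE : ∀ i, i < n → E (w i) (w (i + 1))) (hclose : E (w n) (w 0)) :
    ∃ c : DCycle E, c.m = n + 1 ∧ ∀ i, i ≤ n → c.w i = w i := by
  refine ⟨⟨n + 1, by omega, fun i => if i ≤ n then w i else w 0, by simp, ?_, ?_⟩, rfl, ?_⟩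
  · intro i j hi hj hij
    rw [if_pos (by omega), if_pos (by omega)] at hij
    exact hinj i j (by omega) (by omega) hij
  · intro i hi
    rcases Nat.lt_or_ge i n with hlt | hge
    · simpa [hlt.le, Nat.succ_le_of_lt hlt] using hE i hlt
    · obtain rfl : i = n := by omega
      simpa using hclose
  · intro i hi
    simp [hi]

/-- If every cycle through `y` is the 2-cycle `x ⇄ y`, then the only vertex `b` with an edge to `y`
which is also a descendant of `y` is `x`. -/
theorem eq_of_edge_to_of_cycles {x y b : α} (hc : ∀ c : DCycle E, c.Through y → c.IsTwoCycle x y)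
    (hyb : Anc E y b) (hby : E b y) : b = x := by
  obtain ⟨n, w, h0, hn, hinj, hE⟩ := hyb.exists_simple
  obtain ⟨c, hm, hw⟩ := exists_cycle_of_simple hinj hE (by rwa [hn, h0])
  obtain ⟨h2, h⟩ := hc c ⟨0, by omega, by rw [hw 0 (by omega), h0]⟩
  obtain rfl : n = 1 := by omega
  rw [hw 0 (by omega), hw 1 le_rfl, h0, hn] at h
  rcases h with ⟨hyx, hbY⟩ | ⟨-, hbx⟩
  · rw [hbY, hyx]
  · exact hbx

/-- If every cycle through `y` is the 2-cycle `x ⇄ y`, then the only child of `y`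
which is also an ancestor of `y` is `x`. -/
theorem eq_of_edge_from_of_cycles {x y b : α} (hc : ∀ c : DCycle E, c.Through y → c.IsTwoCycle x y)
    (hyb : E y b) (hby : Anc E b y) : b = x := by
  obtain ⟨n, w, h0, hn, hinj, hE⟩ := hby.exists_simple
  obtain ⟨c, hm, hw⟩ := exists_cycle_of_simple hinj hE (by rwa [hn, h0])
  obtain ⟨h2, h⟩ := hc c ⟨n, by omega, by rw [hw n le_rfl, hn]⟩
  obtain rfl : n = 1 := by omega
  rw [hw 0 (by omega), hw 1 le_rfl, h0, hn] at h
  rcases h with ⟨hbx, -⟩ | ⟨hby, hyx⟩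
  · exact hbx
  · rw [hby, hyx]

namespace DPath

theorem dir_true_of_le {π : DPath E} (hcol : ∀ i, ¬ π.ColliderAt i) {i j : ℕ} (hij : i ≤ j)
    (hj : j < π.n) (hi : π.dir i = true) : π.dir j = true := by
  induction j, hij using Nat.le_induction with
  | base => exact hi
  | succ j hij ih =>
    by_contra h
    exact hcol (j + 1) ⟨by omega, hj, by simpa using ih (by omega), by simpa using h⟩

theorem anc_last {π : DPath E} (hcol : ∀ i, ¬ π.ColliderAt i) {i : ℕ}
    (hi : i < π.n) (hd : π.dir i = true) : Anc E (π.w i) (π.w π.n) :=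
  anc_of_forall_edge hi.le fun k hik hk => (π.valid k hk).1 (dir_true_of_le hcol hik hk hd)

theorem anc_first {π : DPath E} (hcol : ∀ i, ¬ π.ColliderAt i) {i : ℕ}
    (hi : i < π.n) (hd : π.dir i = false) : Anc E (π.w i) (π.w 0) :=
  anc_of_forall_edge_rev (Nat.zero_le i) fun k _ hki => (π.valid k (by omega)).2 <| by
    by_contra h
    have := dir_true_of_le hcol hki.le hi (by simpa using h)
    simp [hd] at this

/-- On a path without colliders, every vertex is an ancestor of an endpoint. -/
theorem anc_first_or_last {π : DPath E} (hcol : ∀ i, ¬ π.ColliderAt i) {i : ℕ}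
    (hi : i ≤ π.n) : Anc E (π.w i) (π.w 0) ∨ Anc E (π.w i) (π.w π.n) := by
  rcases hi.lt_or_eq with hi | rfl
  · cases hd : π.dir i
    · exact .inl (anc_first hcol hi hd)
    · exact .inr (anc_last hcol hi hd)
  · exact .inr .refl

/-- A path without colliders is σ-active. -/
theorem sigmaActive_of_no_collider {π : DPath E} (hcol : ∀ i, ¬ π.ColliderAt i) :
    π.SigmaActive := by
  rintro i ⟨h0, hn, ⟨-, h1⟩, -, h2⟩
  refine hcol i ⟨h0, hn, ?_, ?_⟩
  · by_contra h
    have := (π.valid (i - 1) (by omega)).2 (by simpa using h)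
    rw [Nat.sub_add_cancel h0] at this
    exact h1 this
  · by_contra h
    exact h2 ((π.valid i hn).1 (by simpa using h))

end DPath

/-- The one-edge path traversing the edge `y → x` backwards. -/
def DPath.ofRevEdge {x y : α} (hxy : x ≠ y) (h : E y x) : DPath E where
  n := 1
  pos := le_rfl
  w := fun i => if i = 0 then x else y
  dir := fun _ => false
  inj := by
    intro i j hi hj hij
    interval_cases i <;> interval_cases j <;> simp_all
  valid := by
    intro i hi
    obtain rfl : i = 0 := by omega
    simpa using h

/-- If `a ≠ y` is a parent and a descendant of `x`, then either a cycle through `x` with at least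
two vertices avoids `y`, or a directed path with at least two edges leads from `y` to `x`,
with all intermediate vertices descending from `x`. -/
theorem exists_cycle_or_backdoor {x y a : α} (hxy : x ≠ y) (hxa : Anc E x a) (hax : E a x)
    (hne : a ≠ x) (hay : a ≠ y) :
    HasBigCycleThrough (delVertex E y) x ∨
      ∃ π : DPath E, π.Between x y ∧ (∀ i, π.dir i = false) ∧
        (∀ i, 0 < i → i < π.n → Anc E x (π.w i)) ∧ 2 ≤ π.n := by
  obtain ⟨n, w, h0, hn, hinj, hE⟩ := hxa.exists_simple
  have hn0 : n ≠ 0 := by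
    rintro rfl
    exact hne (hn.symm.trans h0)
  by_cases hk : ∃ k, k ≤ n ∧ w k = y
  · obtain ⟨k, hkn, hky⟩ := hk
    have hk0 : k ≠ 0 := by
      rintro rfl
      exact hxy (h0.symm.trans hky)
    have hkn' : k ≠ n := by
      rintro rfl
      exact hay (hn.symm.trans hky)
    refine .inr ⟨⟨n - k + 1, by omega, fun i => if i = 0 then x else w (n + 1 - i),
      fun _ => false, ?_, ?_⟩, ⟨rfl, ?_⟩, fun _ => rfl, ?_, ?_⟩
    · have key : ∀ i, i ≤ n - k + 1 → (if i = 0 then x else w (n + 1 - i)) =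
          w (if i = 0 then 0 else n + 1 - i) := by
        intro i _
        split_ifs
        · exact h0.symm
        · rfl
      intro i j hi hj hij
      rw [key i hi, key j hj] at hij
      have := hinj _ _ (by split_ifs <;> omega) (by split_ifs <;> omega) hij
      split_ifs at this <;> omega
    · intro i hi
      refine ⟨fun h => by simp at h, fun _ => ?_⟩
      rcases Nat.eq_zero_or_pos i with rfl | hpos
      · simpa [hn] using hax
      · have h := hE (n - i) (by omega)
        rw [show n - i + 1 = n + 1 - i by omega] at h
        simpa [hpos.ne'] using h
    · simp only [Nat.add_eq_zero_iff, one_ne_zero, and_false, if_false]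
      rw [show n + 1 - (n - k + 1) = k by omega, hky]
    · intro i hi hin
      simp only [hi.ne', if_false]
      rw [← h0]
      exact anc_of_forall_edge (Nat.zero_le _) fun j _ hj => hE j (by simp at hin; omega)
    · change 2 ≤ n - k + 1
      omega
  · push Not at hk
    obtain ⟨c, hm, hw⟩ := exists_cycle_of_simple (E := delVertex E y) hinj
      (fun i hi => ⟨hk i hi.le, hk (i + 1) hi, hE i hi⟩)
      ⟨hk n le_rfl, hk 0 (Nat.zero_le _), by rwa [hn, h0]⟩
    exact .inl ⟨c, ⟨0, by omega, by rw [hw 0 (by omega), h0]⟩, by omega⟩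

end Digraph

section TimeSeries

variable {V : Type*} {F : V × ℤ → V × ℤ → Prop} {γmax : ℤ} {S : V → V → Prop}

theorem TemporalPriority.time_le_of_anc (hF : TemporalPriority F) {p q : V × ℤ}
    (h : Anc F p q) : p.2 ≤ q.2 := by
  induction h with
  | refl => exact le_rfl
  | tail _ hbc ih => exact ih.trans (hF _ _ _ _ hbc).1

theorem CandidateSCG.edge (hF : CandidateSCG γmax S F) {p q : V × ℤ} (h : F p q) :
    S p.1 q.1 := by
  obtain ⟨htp, hlag, -, -, rfl⟩ := hF
  refine ⟨q.2, q.2 - p.2, ?_, hlag _ _ _ _ h, ?_⟩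
  · have := (htp _ _ _ _ h).1
    omega
  · simpa using h

theorem CandidateSCG.anc (hF : CandidateSCG γmax S F) {p q : V × ℤ} (h : Anc F p q) :
    Anc S p.1 q.1 := by
  induction h with
  | refl => exact .refl
  | tail _ hbc ih => exact ih.tail (hF.edge hbc)

/-- The vertices strictly after time `T`, together with the descendants of `X` at time `T`. -/
def futureRegion (S : V → V → Prop) (X : V) (T : ℤ) : Set (V × ℤ) :=
  {p | T < p.2 ∨ (p.2 = T ∧ Anc S X p.1)}

theorem mem_futureRegion_of_edge (hF : CandidateSCG γmax S F) {X : V} {T : ℤ} {p q : V × ℤ}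
    (hp : p ∈ futureRegion S X T) (h : F p q) : q ∈ futureRegion S X T := by
  have hle := (hF.1 _ _ _ _ h).1
  rcases hp with hp | ⟨hp, hanc⟩
  · exact .inl (by omega)
  · rcases hle.lt_or_eq with hlt | heq
    · exact .inl (by omega)
    · exact .inr ⟨by omega, hanc.tail (hF.edge h)⟩

theorem mem_futureRegion_of_anc (hF : CandidateSCG γmax S F) {X : V} {T : ℤ} {p q : V × ℤ}
    (hp : p ∈ futureRegion S X T) (h : Anc F p q) : q ∈ futureRegion S X T := by
  induction h with
  | refl => exact hp
  | tail _ hbc ih => exact mem_futureRegion_of_edge hF ih hbc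

theorem notMem_futureRegion_of_mem_Aset {X : V} {t γ : ℤ} {p : V × ℤ}
    (hp : p ∈ Aset γmax S X t γ) : p ∉ futureRegion S X (t - γ) := by
  rintro (h | ⟨h, hanc⟩) <;> rcases hp with ⟨ℓ, h1, -, h2, -⟩ | ⟨ℓ, h1, -, h2, h3⟩
  · omega
  · omega
  · omega
  · exact h3 hanc

theorem mem_Aset_of_edge (hF : CandidateSCG γmax S F) {X : V} {t γ : ℤ} {p q : V × ℤ}
    (hp : p ∉ futureRegion S X (t - γ)) (hq : q ∈ futureRegion S X (t - γ)) (h : F p q) :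
    p ∈ Aset γmax S X t γ := by
  have hlag : q.2 - p.2 ≤ γmax := hF.2.1 _ _ _ _ h
  have hqT : t - γ ≤ q.2 := by rcases hq with hq | hq <;> omega
  simp only [futureRegion, Set.mem_ofPred_eq, not_or, not_and, not_lt] at hp
  by_cases hanc : Anc S X p.1
  · have : p.2 ≠ t - γ := fun he => hp.2 he hanc
    exact .inl ⟨t - γ - p.2, by omega, by omega, by omega, hanc⟩
  · exact .inr ⟨t - γ - p.2, by omega, by omega, by omega, hanc⟩

/-- A path between vertices of the future region which is not blocked by `A_γ` stays in this
region. -/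
theorem mem_futureRegion_of_not_blocks (hF : CandidateSCG γmax S F) {X : V} {t γ : ℤ}
    {π : DPath F} (h0 : π.w 0 ∈ futureRegion S X (t - γ))
    (hn : π.w π.n ∈ futureRegion S X (t - γ)) (hb : ¬ Blocks (Aset γmax S X t γ) π) {i : ℕ}
    (hi : i ≤ π.n) : π.w i ∈ futureRegion S X (t - γ) := by
  induction i with
  | zero => exact h0
  | succ i ih =>
    have hprev := ih (by omega)
    by_contra hnot
    have hlt : i + 1 < π.n := hi.lt_of_ne fun he => hnot (he ▸ hn)
    cases hd : π.dir i
    · have hmem := mem_Aset_of_edge hF hnot hprev ((π.valid i (by omega)).2 hd)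
      exact hb (.inl ⟨i + 1, ⟨by omega, hlt, .inl hd⟩, hmem⟩)
    · exact hnot (mem_futureRegion_of_edge hF hprev ((π.valid i (by omega)).1 hd))

theorem no_collider_of_not_blocks (hF : CandidateSCG γmax S F) {X : V} {t γ : ℤ}
    {π : DPath F} (hR : ∀ i, i ≤ π.n → π.w i ∈ futureRegion S X (t - γ))
    (hb : ¬ Blocks (Aset γmax S X t γ) π) (i : ℕ) : ¬ π.ColliderAt i := fun hc =>
  hb (.inr ⟨i, hc, fun _ hz hanc => notMem_futureRegion_of_mem_Aset hz
    (mem_futureRegion_of_anc hF (hR i hc.2.1.le) hanc)⟩)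

/-- The projection to the summary graph of a path whose vertices are all at time `T`. -/
def DPath.projectContemporaneous (hF : CandidateSCG γmax S F) (π : DPath F) (T : ℤ)
    (hT : ∀ i, i ≤ π.n → (π.w i).2 = T) : DPath S where
  n := π.n
  pos := π.pos
  w := fun i => (π.w i).1
  dir := π.dir
  inj := fun i j hi hj hij => π.inj i j hi hj (Prod.ext hij ((hT i hi).trans (hT j hj).symm))
  valid := fun i hi =>
    ⟨fun hd => hF.edge ((π.valid i hi).1 hd), fun hd => hF.edge ((π.valid i hi).2 hd)⟩

/-- For the 2-cycle `X ⇄ Y` at lag one, every backdoor path through `(Y, T)` that stays in the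
future region has a collider, provided `X ⇄ Y` is the only cycle through `Y`. -/
theorem exists_collider_of_only_twoCycle (hF : CandidateSCG γmax S F) {X Y : V} {T : ℤ}
    (hcyc : ∀ c : DCycle S, c.Through Y → c.IsTwoCycle X Y) {π : DPath F}
    (hbtw : π.Between (X, T) (Y, T + 1)) (hbd : π.Backdoor)
    (hR : ∀ i, i ≤ π.n → π.w i ∈ futureRegion S X T) (h1 : π.w 1 = (Y, T)) :
    ∃ i, π.ColliderAt i := by
  by_contra! hcol
  obtain ⟨hw0, hwn⟩ := hbtw
  have hpos := π.pos
  have hn2 : 2 ≤ π.n := by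
    by_contra hlt
    have hn : π.n = 1 := by omega
    rw [hn, h1] at hwn
    have := congrArg Prod.snd hwn
    simp at this
  have hYX : F (Y, T) (X, T) := by
    have := (π.valid 0 hpos).2 hbd
    rwa [hw0, zero_add, h1] at this
  have hne : π.w 2 ≠ (X, T) := fun he => by
    have := π.inj 2 0 hn2 (Nat.zero_le _) (he.trans hw0.symm)
    omega
  cases hd : π.dir 1
  · have hE := (π.valid 1 hn2).2 hd
    rw [h1] at hE
    have hle := hF.1.time_le_of_anc (.single hE)
    rcases hR 2 hn2 with hlt | ⟨hT, hanc⟩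
    · exact absurd hle (not_le.mpr hlt)
    · have hX := eq_of_edge_to_of_cycles hcyc (hanc.head (hF.edge hYX)) (hF.edge hE)
      exact hne (Prod.ext hX hT)
  · have hE := (π.valid 1 hn2).1 hd
    rw [h1] at hE
    have hlast : Anc F (π.w 2) (Y, T + 1) := by
      rw [← hwn]
      exact anc_of_forall_edge hn2 fun k hk hkn =>
        (π.valid k hkn).1 (DPath.dir_true_of_le hcol (by omega) hkn hd)
    have hX := eq_of_edge_from_of_cycles hcyc (hF.edge hE) (hF.anc hlast)
    have hle : (π.w 2).2 ≤ T + 1 := hF.1.time_le_of_anc hlast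
    have hge : T ≤ (π.w 2).2 := hF.1.time_le_of_anc (.single hE)
    have hneT : (π.w 2).2 ≠ T := fun he => hne (Prod.ext hX he)
    rw [show π.w 2 = (X, T + 1) from Prod.ext hX (by change (π.w 2).2 = T + 1; omega)] at hlast
    exact hF.2.2.2.1 _ (Relation.TransGen.head' ((hF.2.2.1 _ _ _ _ 1).1 hYX) hlast)

end TimeSeries

/-- Theorem 2, graph-theoretic form: if none of the
non-identifiability conditions (1), (2a), (2b), (2c) holds, then `A_γ`
satisfies the backdoor criterion over all candidate FTCGs relative to
`((X, t−γ), (Y, t))`.  Here a path of the SCG with `n` edges has `n + 1`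
vertices, so the paper's `n = 2` (resp. `n > 2`) corresponds to `π.n = 1`
(resp. `2 ≤ π.n`). -/
theorem theorem2_Aset_backdoor_criterion {V : Type*} [Fintype V] [Nonempty V]
    (γmax : ℤ) (hγmax : 1 ≤ γmax)
    (S : V → V → Prop) (X Y : V) (hXY : X ≠ Y) (hanc : Anc S X Y)
    (t γ : ℤ) (hγ : 0 ≤ γ)
    (hcond : ¬ ((γ ≠ 0 ∧ HasBigCycleThrough (delVertex S Y) X) ∨
      (∃ πs : DPath S, πs.Between X Y ∧ πs.Backdoor ∧ πs.SigmaActive ∧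
        (∀ i, 0 < i → i < πs.n → Anc S X (πs.w i)) ∧
        (2 ≤ πs.n ∨ (πs.n = 1 ∧ γ ≠ 1) ∨
          (πs.n = 1 ∧ γ = 1 ∧
            ∃ c : DCycle S, c.Through Y ∧ ¬ c.IsTwoCycle X Y))))) :
    SatisfiesBackdoorCriterionAll (CandidateSCG γmax S)
      (Aset γmax S X t γ) (X, t - γ) (Y, t) := by
  have hXR : (X, t - γ) ∈ futureRegion S X (t - γ) := .inr ⟨rfl, .refl⟩
  have hYR : (Y, t) ∈ futureRegion S X (t - γ) := by
    rcases hγ.lt_or_eq with hlt | heq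
    · exact .inl (by change t - γ < t; omega)
    · exact .inr ⟨by change t = t - γ; omega, hanc⟩
  refine ⟨fun h => notMem_futureRegion_of_mem_Aset h hXR,
    fun h => notMem_futureRegion_of_mem_Aset h hYR, fun F hF => ⟨fun π hbtw hbd => ?_,
    fun p hp h => notMem_futureRegion_of_mem_Aset hp (mem_futureRegion_of_anc hF hXR h)⟩⟩
  by_contra hb
  obtain ⟨hw0, hwn⟩ := hbtw
  have hR : ∀ i, i ≤ π.n → π.w i ∈ futureRegion S X (t - γ) := fun i hi =>
    mem_futureRegion_of_not_blocks hF (by rwa [hw0]) (by rwa [hwn]) hb hi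
  have hcol := no_collider_of_not_blocks hF hR hb
  have hpos := π.pos
  have hcontra : ∀ πs : DPath S, πs.Between X Y → πs.Backdoor → (∀ i, ¬ πs.ColliderAt i) →
      (∀ i, 0 < i → i < πs.n → Anc S X (πs.w i)) →
      ¬ (2 ≤ πs.n ∨ (πs.n = 1 ∧ γ ≠ 1) ∨
          (πs.n = 1 ∧ γ = 1 ∧ ∃ c : DCycle S, c.Through Y ∧ ¬ c.IsTwoCycle X Y)) :=
    fun πs h1 h2 h3 h4 h5 =>
      hcond (.inr ⟨πs, h1, h2, DPath.sigmaActive_of_no_collider h3, h4, h5⟩)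
  rcases eq_or_ne γ 0 with rfl | hγ0
  · have hT : ∀ i, i ≤ π.n → (π.w i).2 = t ∧ Anc S X (π.w i).1 := by
      intro i hi
      have hle : (π.w i).2 ≤ t := by
        rcases DPath.anc_first_or_last hcol hi with h | h <;>
          have := hF.1.time_le_of_anc h
        · rw [hw0] at this
          simpa using this
        · rwa [hwn] at this
      rcases hR i hi with h | ⟨h, h'⟩
      · omega
      · exact ⟨by omega, h'⟩
    refine hcontra (π.projectContemporaneous hF t fun i hi => (hT i hi).1)
      ⟨congrArg Prod.fst hw0, congrArg Prod.fst hwn⟩ hbd hcol (fun i _ hi => (hT i hi.le).2) ?_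
    change 2 ≤ π.n ∨ (π.n = 1 ∧ _) ∨ _
    rcases hpos.lt_or_eq with h | h
    · exact .inl h
    · exact .inr (.inl ⟨h.symm, by norm_num⟩)
  · have hE := (π.valid 0 hpos).2 hbd
    rw [zero_add, hw0] at hE
    have hle : (π.w 1).2 ≤ t - γ := hF.1.time_le_of_anc (.single hE)
    obtain ⟨hT, hA⟩ : (π.w 1).2 = t - γ ∧ Anc S X (π.w 1).1 := by
      rcases hR 1 hpos with h | h
      · omega
      · exact h
    have hAX : (π.w 1).1 ≠ X := fun he => by
      have := π.inj 1 0 hpos (Nat.zero_le _) ((Prod.ext he hT : π.w 1 = (X, t - γ)).trans hw0.symm)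
      omega
    rcases eq_or_ne (π.w 1).1 Y with hY | hY
    · have hYX : S Y X := hY ▸ hF.edge hE
      have hrev := hcontra (.ofRevEdge hXY hYX) ⟨rfl, rfl⟩ rfl
        (fun i hc => Bool.false_ne_true hc.2.2.1)
        fun i h0 h1 => absurd h1 (by change ¬ i < 1; omega)
      have hγ1 : γ = 1 := by
        by_contra h
        exact hrev (.inr (.inl ⟨rfl, h⟩))
      subst hγ1
      have hcyc : ∀ c : DCycle S, c.Through Y → c.IsTwoCycle X Y := fun c hc => by
        by_contra h
        exact hrev (.inr (.inr ⟨rfl, rfl, c, hc, h⟩))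
      obtain ⟨i, hi⟩ := exists_collider_of_only_twoCycle hF hcyc
        ⟨hw0, by rw [hwn, sub_add_cancel]⟩ hbd hR (Prod.ext hY hT)
      exact hcol i hi
    · rcases exists_cycle_or_backdoor hXY hA (hF.edge hE) hAX hY with h | ⟨πs, h1, h2, h3, h4⟩
      · exact hcond (.inl ⟨hγ0, h⟩)
      · exact hcontra πs h1 (h2 0) (fun i hc => by simpa [h2] using hc.2.2.1) h3 (.inl h4)
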